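/- Assume (UM): g satisfies (H), L_g = g'(0), and g is bounded. Let w₀ satisfy (IC1). Let c > c_# (i.e. χ₀(·;c) has two distinct positive real zeros λ₁(c) < λ₂(c)), fix λ ∈ (λ₁(c), λ₂(c)), and let φ be a semi-wavefront with speed c such that sup_{s∈[−h,0]} |φ(·+cs) − w₀(s,·)|_λ < ∞. Then there exist C > 0 and γ > 0 such that every classical solution u of (*) with initial datum w₀ satisfies sup_{x∈ℝ} |u(t,x) − φ(x+ct)| / e^{λ(x+ct)} ≤ C e^{−γt} for all t ≥ 0. -/

import Mathlib

open Set Filter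

noncomputable section

/-- The weight function `η_λ(t) = min{e^{λt}, 1}`. -/
def eta (lam t : ℝ) : ℝ := min (Real.exp (lam * t)) 1

/-- The characteristic function `χ₀(λ) = λ² − cλ − 1 + g0·e^{−λch}` (with `g0 = g'(0)`). -/
def chi (g0 c h lam : ℝ) : ℝ := lam ^ 2 - c * lam - 1 + g0 * Real.exp (-(lam * c * h))

/-- Hypothesis (H) on the birth function `g` (extended linearly and C¹-smoothly to `(−∞,0]`). -/
structure HypH (g : ℝ → ℝ) (kap del0 Lg : ℝ) : Prop where
  cont : Continuous g
  nonneg : ∀ x : ℝ, 0 ≤ x → 0 ≤ g x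
  kap_pos : 0 < kap
  del0_pos : 0 < del0
  fixed_points : ∀ x : ℝ, 0 ≤ x → (g x = x ↔ x = 0 ∨ x = kap)
  smooth0 : ContDiffOn ℝ 1 g (Set.Ioo (-del0) del0)
  smooth_kap : ContDiffOn ℝ 1 g (Set.Ioo (kap - del0) (kap + del0))
  deriv0_gt : 1 < deriv g 0
  deriv_kap_lt : deriv g kap < 1
  lipschitz : ∀ u v : ℝ, 0 ≤ u → 0 ≤ v → |g u - g v| ≤ Lg * |u - v|
  holder : ∃ C > (0:ℝ), ∃ θ ∈ Set.Ioc (0:ℝ) 1,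
      ∀ u ∈ Set.Ioc (0:ℝ) del0, |deriv g u - deriv g 0| ≤ C * u ^ θ
  ext_linear : ∀ x : ℝ, x ≤ 0 → g x = deriv g 0 * x

/-- (IC1): `0 ≤ w₀ ≤ sup w₀ < ∞` on `Π₀ = [−h,0]×ℝ`. -/
def IC1 (h : ℝ) (w0 : ℝ → ℝ → ℝ) : Prop :=
  ∃ M : ℝ, ∀ s ∈ Set.Icc (-h) 0, ∀ x : ℝ, 0 ≤ w0 s x ∧ w0 s x ≤ M

/-- (IC2): `liminf_{x→+∞} min_{s∈[−h,0]} w₀(s,x) > 0`. -/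
def IC2 (h : ℝ) (w0 : ℝ → ℝ → ℝ) : Prop :=
  ∃ m > (0:ℝ), ∃ X : ℝ, ∀ x ≥ X, ∀ s ∈ Set.Icc (-h) 0, m ≤ w0 s x

/-- `w₀` is locally Hölder continuous in `x`, uniformly in `s ∈ [−h,0]`. -/
def LocHolder (h : ℝ) (w0 : ℝ → ℝ → ℝ) : Prop :=
  ∀ R > (0:ℝ), ∃ K > (0:ℝ), ∃ β ∈ Set.Ioc (0:ℝ) 1,
    ∀ s ∈ Set.Icc (-h) 0, ∀ x ∈ Set.Icc (-R) R, ∀ y ∈ Set.Icc (-R) R,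
      |w0 s x - w0 s y| ≤ K * |x - y| ^ β

/-- A classical solution of the equation (*):
`u_t(t,x) = u_{xx}(t,x) − u(t,x) + g(u(t−h,x))` for `t > 0`, `x ∈ ℝ`. -/
def SolvesStar (g : ℝ → ℝ) (h : ℝ) (u : ℝ → ℝ → ℝ) : Prop :=
  ContinuousOn (fun p : ℝ × ℝ => u p.1 p.2) {p : ℝ × ℝ | -h ≤ p.1} ∧
  (∀ T : ℝ, ∃ M : ℝ, ∀ t ∈ Set.Icc (-h) T, ∀ x : ℝ, |u t x| ≤ M) ∧
  (∀ t : ℝ, 0 < t → ∀ x : ℝ,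
      DifferentiableAt ℝ (fun τ => u τ x) t ∧
      DifferentiableAt ℝ (fun y => u t y) x ∧
      DifferentiableAt ℝ (deriv (fun y => u t y)) x ∧
      deriv (fun τ => u τ x) t =
        deriv (deriv (fun y => u t y)) x - u t x + g (u (t - h) x)) ∧
  ContinuousOn (fun p : ℝ × ℝ => deriv (fun τ => u τ p.2) p.1) {p : ℝ × ℝ | 0 < p.1} ∧
  ContinuousOn (fun p : ℝ × ℝ => deriv (fun y => u p.1 y) p.2) {p : ℝ × ℝ | 0 < p.1} ∧
  ContinuousOn (fun p : ℝ × ℝ => deriv (deriv (fun y => u p.1 y)) p.2) {p : ℝ × ℝ | 0 < p.1}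

/-- A classical solution of equation (E1):
`w_t = w_{zz} − c w_z − w + g(w(t−h, z−ch))` for `t > 0`, `z ∈ ℝ`. -/
def SolvesE1 (g : ℝ → ℝ) (h c : ℝ) (w : ℝ → ℝ → ℝ) : Prop :=
  ContinuousOn (fun p : ℝ × ℝ => w p.1 p.2) {p : ℝ × ℝ | -h ≤ p.1} ∧
  (∀ T : ℝ, ∃ M : ℝ, ∀ t ∈ Set.Icc (-h) T, ∀ z : ℝ, |w t z| ≤ M) ∧
  (∀ t : ℝ, 0 < t → ∀ z : ℝ,
      DifferentiableAt ℝ (fun τ => w τ z) t ∧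
      DifferentiableAt ℝ (fun y => w t y) z ∧
      DifferentiableAt ℝ (deriv (fun y => w t y)) z ∧
      deriv (fun τ => w τ z) t =
        deriv (deriv (fun y => w t y)) z - c * deriv (fun y => w t y) z
          - w t z + g (w (t - h) (z - c * h))) ∧
  ContinuousOn (fun p : ℝ × ℝ => deriv (fun τ => w τ p.2) p.1) {p : ℝ × ℝ | 0 < p.1} ∧
  ContinuousOn (fun p : ℝ × ℝ => deriv (fun y => w p.1 y) p.2) {p : ℝ × ℝ | 0 < p.1} ∧
  ContinuousOn (fun p : ℝ × ℝ => deriv (deriv (fun y => w p.1 y)) p.2) {p : ℝ × ℝ | 0 < p.1}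

/-- A wavefront with speed `c`: a positive bounded C² solution of the profile equation
with `φ(−∞) = 0`, `φ(+∞) = κ`. -/
def IsWavefront (g : ℝ → ℝ) (h c kap : ℝ) (φ : ℝ → ℝ) : Prop :=
  (∀ z : ℝ, 0 < φ z) ∧ (∃ M : ℝ, ∀ z : ℝ, φ z ≤ M) ∧ ContDiff ℝ 2 φ ∧
  (∀ z : ℝ, deriv (deriv φ) z - c * deriv φ z - φ z + g (φ (z - c * h)) = 0) ∧
  Filter.Tendsto φ Filter.atBot (nhds 0) ∧ Filter.Tendsto φ Filter.atTop (nhds kap)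

/-- A semi-wavefront with speed `c`: as a wavefront, but at `+∞` only
`liminf_{z→+∞} φ(z) > 0` is required. -/
def IsSemiWavefront (g : ℝ → ℝ) (h c : ℝ) (φ : ℝ → ℝ) : Prop :=
  (∀ z : ℝ, 0 < φ z) ∧ (∃ M : ℝ, ∀ z : ℝ, φ z ≤ M) ∧ ContDiff ℝ 2 φ ∧
  (∀ z : ℝ, deriv (deriv φ) z - c * deriv φ z - φ z + g (φ (z - c * h)) = 0) ∧
  Filter.Tendsto φ Filter.atBot (nhds 0) ∧
  (∃ m > (0:ℝ), ∀ᶠ z in Filter.atTop, m ≤ φ z)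

/-- The nonlinear operator `𝒩` associated with (E1). -/
def Nop (g : ℝ → ℝ) (h c : ℝ) (w : ℝ → ℝ → ℝ) (t z : ℝ) : ℝ :=
  deriv (fun τ => w τ z) t - deriv (deriv (fun y => w t y)) z
    + c * deriv (fun y => w t y) z + w t z - g (w (t - h) (z - c * h))

/-- A super-solution of (E1) with break point `zs`. -/
def IsSuperSolution (g : ℝ → ℝ) (h c : ℝ) (w : ℝ → ℝ → ℝ) (zs : ℝ) : Prop :=
  ContinuousOn (fun p : ℝ × ℝ => w p.1 p.2) {p : ℝ × ℝ | -h ≤ p.1} ∧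
  (∀ t : ℝ, -h < t → ∀ z : ℝ, DifferentiableAt ℝ (fun τ => w τ z) t) ∧
  (∀ t : ℝ, -h ≤ t → ∀ z : ℝ, z ≠ zs →
      DifferentiableAt ℝ (fun y => w t y) z ∧
      DifferentiableAt ℝ (deriv (fun y => w t y)) z) ∧
  (∀ t : ℝ, 0 < t → ∀ z : ℝ, z ≠ zs → 0 ≤ Nop g h c w t z) ∧
  (∀ t : ℝ, 0 < t →
      derivWithin (fun y => w t y) (Set.Iic zs) zs
        > derivWithin (fun y => w t y) (Set.Ici zs) zs)

/-- A sub-solution of (E1) with break point `zs` (all inequalities reversed). -/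
def IsSubSolution (g : ℝ → ℝ) (h c : ℝ) (w : ℝ → ℝ → ℝ) (zs : ℝ) : Prop :=
  ContinuousOn (fun p : ℝ × ℝ => w p.1 p.2) {p : ℝ × ℝ | -h ≤ p.1} ∧
  (∀ t : ℝ, -h < t → ∀ z : ℝ, DifferentiableAt ℝ (fun τ => w τ z) t) ∧
  (∀ t : ℝ, -h ≤ t → ∀ z : ℝ, z ≠ zs →
      DifferentiableAt ℝ (fun y => w t y) z ∧
      DifferentiableAt ℝ (deriv (fun y => w t y)) z) ∧
  (∀ t : ℝ, 0 < t → ∀ z : ℝ, z ≠ zs → Nop g h c w t z ≤ 0) ∧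
  (∀ t : ℝ, 0 < t →
      derivWithin (fun y => w t y) (Set.Iic zs) zs
        < derivWithin (fun y => w t y) (Set.Ici zs) zs)

/-- A global minimum point of a differentiable function has nonnegative second derivative. -/
theorem second_deriv_nonneg_of_forall_le {f f' : ℝ → ℝ} {f'' x₀ : ℝ}
    (hf : ∀ x, HasDerivAt f (f' x) x) (hf' : HasDerivAt f' f'' x₀)
    (hmin : ∀ x, f x₀ ≤ f x) : 0 ≤ f'' := by
  by_contra! hneg
  have hloc : IsLocalMin f x₀ := Eventually.of_forall hmin
  have hd : deriv f = f' := funext fun x => (hf x).deriv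
  have hmax : IsLocalMax f x₀ := by
    apply isLocalMax_of_deriv_deriv_neg
    · rwa [hd, hf'.deriv]
    · exact hloc.deriv_eq_zero
    · exact (hf x₀).continuousAt
  have hconst : f =ᶠ[nhds x₀] fun _ => f x₀ :=
    hmax.mono fun x hx => le_antisymm hx (hmin x)
  have hzero : f' =ᶠ[nhds x₀] fun _ => 0 := by
    have := hconst.deriv
    rwa [hd, deriv_const'] at this
  have := hzero.deriv_eq
  rw [hf'.deriv, deriv_const] at this
  exact hneg.ne this

/-- If `f` lies above `f t₀` to the left of `t₀`, then its derivative at `t₀` is nonpositive. -/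
theorem deriv_nonpos_of_forall_lt_le {f : ℝ → ℝ} {f' t₀ s : ℝ} (hs : s < t₀)
    (hf : HasDerivAt f f' t₀) (hle : ∀ t ∈ Ioo s t₀, f t₀ ≤ f t) : f' ≤ 0 := by
  have hlim := (hasDerivAt_iff_tendsto_slope.1 hf).mono_left
    (nhdsWithin_mono t₀ (show Iio t₀ ⊆ {t₀}ᶜ from fun t ht => ne_of_lt ht))
  refine le_of_tendsto hlim ?_
  filter_upwards [Ioo_mem_nhdsLT hs] with t ht
  rw [slope_def_field]
  exact div_nonpos_of_nonneg_of_nonpos (sub_nonneg.2 (hle t ht)) (sub_nonpos.2 ht.2.le)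

/-- An exponential travelling supersolution perturbed by a term growing at `±∞` in space. -/
def barrier (K a lam ε b t x : ℝ) : ℝ :=
  K * Real.exp (a * t + lam * x) + ε * (Real.exp (b * t) * Real.cosh x)

theorem barrier_hasDerivAt_time (K a lam ε b t x : ℝ) :
    HasDerivAt (fun τ => barrier K a lam ε b τ x)
      (a * (K * Real.exp (a * t + lam * x)) + b * (ε * (Real.exp (b * t) * Real.cosh x))) t := by
  have h1 := ((((hasDerivAt_id t).const_mul a).add_const (lam * x)).exp).const_mul K
  have h2 := ((((hasDerivAt_id t).const_mul b).exp).mul_const (Real.cosh x)).const_mul ε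
  refine (h1.add h2).congr_deriv ?_
  simp only [id]
  ring

theorem barrier_hasDerivAt_space (K a lam ε b t x : ℝ) :
    HasDerivAt (fun y => barrier K a lam ε b t y)
      (K * lam * Real.exp (a * t + lam * x) + ε * (Real.exp (b * t) * Real.sinh x)) x := by
  have h1 := ((((hasDerivAt_id x).const_mul lam).const_add (a * t)).exp).const_mul K
  have h2 := (((Real.hasDerivAt_cosh x).const_mul (Real.exp (b * t)))).const_mul ε
  refine (h1.add h2).congr_deriv ?_
  simp only [id]
  ring

theorem barrier_hasDerivAt_space_space (K a lam ε b t x : ℝ) :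
    HasDerivAt
      (fun y => K * lam * Real.exp (a * t + lam * y) + ε * (Real.exp (b * t) * Real.sinh y))
      (lam ^ 2 * (K * Real.exp (a * t + lam * x)) + ε * (Real.exp (b * t) * Real.cosh x)) x := by
  have h1 := ((((hasDerivAt_id x).const_mul lam).const_add (a * t)).exp).const_mul (K * lam)
  have h2 := (((Real.hasDerivAt_sinh x).const_mul (Real.exp (b * t)))).const_mul ε
  refine (h1.add h2).congr_deriv ?_
  simp only [id]
  ring

/-- The barrier is a strict supersolution of the linear delayed equation. -/
theorem barrier_strict_super {L h K a lam ε : ℝ} (hL : 0 ≤ L) (hh : 0 ≤ h) (hK : 0 ≤ K)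
    (hε : 0 < ε) (ha : L * Real.exp (-(a * h)) ≤ a - lam ^ 2 + 1) (t x : ℝ) :
    L * barrier K a lam ε (L + 1) (t - h) x <
      (a * (K * Real.exp (a * t + lam * x))
          + (L + 1) * (ε * (Real.exp ((L + 1) * t) * Real.cosh x)))
        - (lam ^ 2 * (K * Real.exp (a * t + lam * x))
          + ε * (Real.exp ((L + 1) * t) * Real.cosh x))
        + barrier K a lam ε (L + 1) t x := by
  have e1 : Real.exp (a * (t - h) + lam * x)
      = Real.exp (-(a * h)) * Real.exp (a * t + lam * x) := by
    rw [← Real.exp_add]; ring_nf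
  have e2 : Real.exp ((L + 1) * (t - h))
      = Real.exp (-((L + 1) * h)) * Real.exp ((L + 1) * t) := by
    rw [← Real.exp_add]; ring_nf
  have hE : 0 ≤ K * Real.exp (a * t + lam * x) := by positivity
  have hF : 0 < ε * (Real.exp ((L + 1) * t) * Real.cosh x) := by
    have := Real.cosh_pos x
    positivity
  have hb : Real.exp (-((L + 1) * h)) ≤ 1 := Real.exp_le_one_iff.2 (by
    have : 0 ≤ (L + 1) * h := by positivity
    linarith)
  have hb' : L * Real.exp (-((L + 1) * h)) < L + 1 := by
    nlinarith
  have k1 := mul_le_mul_of_nonneg_right ha hE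
  have k2 := mul_lt_mul_of_pos_right hb' hF
  unfold barrier
  rw [e1, e2]
  linarith

/-- A solution of the delayed differential inequality cannot touch the barrier from below. -/
theorem not_touch_barrier {L h K a lam ε t₀ x₀ s dt dxx : ℝ} {D : ℝ → ℝ → ℝ} {dx : ℝ → ℝ}
    (hL : 0 ≤ L) (hh : 0 ≤ h) (hK : 0 ≤ K)
    (hε : 0 < ε) (ha : L * Real.exp (-(a * h)) ≤ a - lam ^ 2 + 1) (hs : s < t₀)
    (hdt : HasDerivAt (fun τ => D τ x₀) dt t₀)
    (hdx : ∀ x, HasDerivAt (fun y => D t₀ y) (dx x) x) (hdxx : HasDerivAt dx dxx x₀)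
    (heq : dt - dxx + D t₀ x₀ ≤ L * |D (t₀ - h) x₀|)
    (hpast : |D (t₀ - h) x₀| ≤ barrier K a lam ε (L + 1) (t₀ - h) x₀)
    (hleft : ∀ t ∈ Ioo s t₀, D t x₀ ≤ barrier K a lam ε (L + 1) t x₀)
    (hslice : ∀ x, D t₀ x ≤ barrier K a lam ε (L + 1) t₀ x)
    (htouch : barrier K a lam ε (L + 1) t₀ x₀ ≤ D t₀ x₀) : False := by
  have h1 := deriv_nonpos_of_forall_lt_le hs
    ((barrier_hasDerivAt_time K a lam ε (L + 1) t₀ x₀).sub hdt) (fun t ht => by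
      have := hleft t ht
      simp only [Pi.sub_apply]
      linarith)
  have h2 := second_deriv_nonneg_of_forall_le
    (fun x => (barrier_hasDerivAt_space K a lam ε (L + 1) t₀ x).sub (hdx x))
    ((barrier_hasDerivAt_space_space K a lam ε (L + 1) t₀ x₀).sub hdxx) (fun x => by
      have := hslice x
      simp only [Pi.sub_apply]
      linarith)
  have h3 := barrier_strict_super hL hh hK hε ha t₀ x₀
  have h4 := mul_le_mul_of_nonneg_left hpast hL
  linarith

theorem abs_lt_barrier_of_large {K a lam ε b h t x M : ℝ} (hK : 0 ≤ K) (hε : 0 < ε) (hb : 0 ≤ b)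
    (ht : -h ≤ t) (hx : 2 * M * Real.exp (b * h) / ε < |x|) :
    M < barrier K a lam ε b t x := by
  have hcosh : |x| < 2 * Real.cosh x := by
    rw [← Real.cosh_abs, Real.cosh_eq]
    have := Real.add_one_le_exp |x|
    have := Real.exp_pos (-|x|)
    linarith
  have hexp : Real.exp (-(b * h)) ≤ Real.exp (b * t) := Real.exp_le_exp.2 (by nlinarith)
  have hE : 0 ≤ K * Real.exp (a * t + lam * x) := by positivity
  have hM : 2 * M * Real.exp (b * h) < 2 * Real.cosh x * ε := by
    rw [div_lt_iff₀ hε] at hx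
    nlinarith
  have hM' : M < Real.exp (-(b * h)) * (Real.cosh x * ε) := by
    have hpos := Real.exp_pos (-(b * h))
    have hinv : Real.exp (-(b * h)) * Real.exp (b * h) = 1 := by
      rw [← Real.exp_add]; simp
    have := mul_lt_mul_of_pos_left hM hpos
    have e : Real.exp (-(b * h)) * (2 * M * Real.exp (b * h))
        = 2 * M * (Real.exp (-(b * h)) * Real.exp (b * h)) := by ring
    rw [e, hinv] at this
    linarith
  have hc : 0 ≤ Real.cosh x * ε := by
    have := Real.cosh_pos x
    positivity
  have := mul_le_mul_of_nonneg_right hexp hc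
  unfold barrier
  linarith

theorem continuous_barrier (K a lam ε b : ℝ) :
    Continuous fun p : ℝ × ℝ => barrier K a lam ε b p.1 p.2 := by
  unfold barrier
  have := Real.continuous_cosh
  fun_prop

/-- Comparison of a solution of the delayed differential inequality with the barrier. -/
theorem abs_lt_barrier {L h K a lam ε : ℝ} {D dt dx dxx : ℝ → ℝ → ℝ}
    (hL : 0 ≤ L) (hh : 0 < h) (hK : 0 ≤ K) (hε : 0 < ε)
    (ha : L * Real.exp (-(a * h)) ≤ a - lam ^ 2 + 1)
    (hcont : ContinuousOn (fun p : ℝ × ℝ => D p.1 p.2) {p : ℝ × ℝ | -h ≤ p.1})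
    (hbdd : ∀ T : ℝ, ∃ M : ℝ, ∀ t ∈ Icc (-h) T, ∀ x : ℝ, |D t x| ≤ M)
    (hdt : ∀ t, 0 < t → ∀ x, HasDerivAt (fun τ => D τ x) (dt t x) t)
    (hdx : ∀ t, 0 < t → ∀ x, HasDerivAt (fun y => D t y) (dx t x) x)
    (hdxx : ∀ t, 0 < t → ∀ x, HasDerivAt (fun y => dx t y) (dxx t x) x)
    (heq : ∀ t, 0 < t → ∀ x, |dt t x - dxx t x + D t x| ≤ L * |D (t - h) x|)
    (hinit : ∀ s ∈ Icc (-h) 0, ∀ x, |D s x| ≤ K * Real.exp (a * s + lam * x))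
    {T x : ℝ} (hT : 0 ≤ T) : |D T x| < barrier K a lam ε (L + 1) T x := by
  by_contra! hbad
  obtain ⟨M, hM⟩ := hbdd T
  set R := 2 * M * Real.exp ((L + 1) * h) / ε
  have hfar : ∀ t ∈ Icc (-h) T, ∀ y, R < |y| → |D t y| < barrier K a lam ε (L + 1) t y :=
    fun t ht y hy => (hM t ht y).trans_lt
      (abs_lt_barrier_of_large hK hε (by positivity) ht.1 hy)
  have hstart : ∀ t ∈ Icc (-h) 0, ∀ y, |D t y| < barrier K a lam ε (L + 1) t y := by
    intro t ht y
    have hF : 0 < ε * (Real.exp ((L + 1) * t) * Real.cosh y) := by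
      have := Real.cosh_pos y
      positivity
    have := hinit t ht y
    unfold barrier
    linarith
  have hcomp : IsCompact ((Icc 0 T ×ˢ Icc (-R) R) ∩
      (fun p : ℝ × ℝ => |D p.1 p.2| - barrier K a lam ε (L + 1) p.1 p.2) ⁻¹' Ici 0) := by
    refine (isCompact_Icc.prod isCompact_Icc).of_isClosed_subset ?_ inter_subset_left
    refine ContinuousOn.preimage_isClosed_of_isClosed ?_ (isClosed_Icc.prod isClosed_Icc)
      isClosed_Ici
    refine ContinuousOn.sub (hcont.mono ?_).abs (continuous_barrier _ _ _ _ _).continuousOn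
    intro p hp
    have := hp.1.1
    exact (neg_nonpos.2 hh.le).trans this
  have hne : ((Icc 0 T ×ˢ Icc (-R) R) ∩
      (fun p : ℝ × ℝ => |D p.1 p.2| - barrier K a lam ε (L + 1) p.1 p.2) ⁻¹' Ici 0).Nonempty := by
    refine ⟨(T, x), ⟨⟨hT, le_rfl⟩, ?_⟩, sub_nonneg.2 hbad⟩
    refine abs_le.1 ?_
    by_contra! hx
    exact (hfar T ⟨by linarith, le_rfl⟩ x hx).not_ge hbad
  obtain ⟨⟨t₀, x₀⟩, ⟨⟨ht₀, -⟩, htouch⟩, hmin⟩ := hcomp.exists_isMinOn hne continuous_fst.continuousOn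
  replace htouch : barrier K a lam ε (L + 1) t₀ x₀ ≤ |D t₀ x₀| := sub_nonneg.1 htouch
  have ht₀pos : 0 < t₀ := by
    by_contra! hle
    exact (hstart t₀ ⟨by linarith [ht₀.1], hle⟩ x₀).not_ge htouch
  have hbefore : ∀ t, -h ≤ t → t < t₀ → ∀ y, |D t y| < barrier K a lam ε (L + 1) t y := by
    intro t ht htt y
    rcases le_or_gt t 0 with h0 | h0
    · exact hstart t ⟨ht, h0⟩ y
    by_contra! hy
    have htT : t ≤ T := htt.le.trans ht₀.2
    have hyR : |y| ≤ R := by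
      by_contra! hyR
      exact (hfar t ⟨ht, htT⟩ y hyR).not_ge hy
    have := hmin (a := (t, y)) ⟨⟨⟨h0.le, htT⟩, abs_le.1 hyR⟩, sub_nonneg.2 hy⟩
    exact (not_lt.2 this) htt
  have hslice : ∀ y, |D t₀ y| ≤ barrier K a lam ε (L + 1) t₀ y := by
    intro y
    have c1 := ((hdt t₀ ht₀pos y).continuousAt.abs).tendsto.mono_left
      (nhdsWithin_le_nhds (s := Iio t₀))
    have c2 := (barrier_hasDerivAt_time K a lam ε (L + 1) t₀ y).continuousAt.tendsto.mono_left
      (nhdsWithin_le_nhds (s := Iio t₀))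
    refine le_of_tendsto_of_tendsto c1 c2 ?_
    filter_upwards [Ioo_mem_nhdsLT ht₀pos] with t ht
    exact (hbefore t (by linarith [ht.1]) ht.2 y).le
  have hpast := (hbefore (t₀ - h) (by linarith) (by linarith) x₀).le
  have hEq := abs_le.1 (heq t₀ ht₀pos x₀)
  rcases le_abs.1 htouch with hpos | hneg
  · exact not_touch_barrier hL hh.le hK hε ha ht₀pos (hdt t₀ ht₀pos x₀) (hdx t₀ ht₀pos)
      (hdxx t₀ ht₀pos x₀) hEq.2 hpast
      (fun t ht => (le_abs_self _).trans (hbefore t (by linarith [ht.1]) ht.2 x₀).le)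
      (fun y => (le_abs_self _).trans (hslice y)) hpos
  · exact not_touch_barrier (D := fun t y => -D t y) hL hh.le hK hε ha ht₀pos
      (hdt t₀ ht₀pos x₀).neg (fun y => (hdx t₀ ht₀pos y).neg)
      (hdxx t₀ ht₀pos x₀).neg (by rw [abs_neg]; linarith [hEq.1]) (by rwa [abs_neg])
      (fun t ht => (neg_le_abs _).trans (hbefore t (by linarith [ht.1]) ht.2 x₀).le)
      (fun y => (neg_le_abs _).trans (hslice y)) hneg

/-- Exponential bound for bounded solutions of the delayed differential inequality. -/
theorem abs_le_exp_of_delayed_inequality {L h K a lam : ℝ} {D dt dx dxx : ℝ → ℝ → ℝ}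
    (hL : 0 ≤ L) (hh : 0 < h) (hK : 0 ≤ K)
    (ha : L * Real.exp (-(a * h)) ≤ a - lam ^ 2 + 1)
    (hcont : ContinuousOn (fun p : ℝ × ℝ => D p.1 p.2) {p : ℝ × ℝ | -h ≤ p.1})
    (hbdd : ∀ T : ℝ, ∃ M : ℝ, ∀ t ∈ Icc (-h) T, ∀ x : ℝ, |D t x| ≤ M)
    (hdt : ∀ t, 0 < t → ∀ x, HasDerivAt (fun τ => D τ x) (dt t x) t)
    (hdx : ∀ t, 0 < t → ∀ x, HasDerivAt (fun y => D t y) (dx t x) x)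
    (hdxx : ∀ t, 0 < t → ∀ x, HasDerivAt (fun y => dx t y) (dxx t x) x)
    (heq : ∀ t, 0 < t → ∀ x, |dt t x - dxx t x + D t x| ≤ L * |D (t - h) x|)
    (hinit : ∀ s ∈ Icc (-h) 0, ∀ x, |D s x| ≤ K * Real.exp (a * s + lam * x))
    {t : ℝ} (ht : 0 ≤ t) (x : ℝ) : |D t x| ≤ K * Real.exp (a * t + lam * x) := by
  have hlim : Tendsto (fun ε : ℝ => barrier K a lam ε (L + 1) t x) (nhdsWithin 0 (Ioi 0))
      (nhds (K * Real.exp (a * t + lam * x))) := by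
    have hc : Continuous fun ε : ℝ => barrier K a lam ε (L + 1) t x := by
      unfold barrier
      fun_prop
    have := hc.tendsto 0
    simp only [barrier, zero_mul, add_zero] at this
    exact this.mono_left nhdsWithin_le_nhds
  refine ge_of_tendsto hlim ?_
  filter_upwards [self_mem_nhdsWithin] with ε hε
  exact (abs_lt_barrier hL hh hK hε ha hcont hbdd hdt hdx hdxx heq hinit ht).le

/-- The characteristic function is negative strictly between two of its zeros. -/
theorem chi_neg_of_mem_Ioo {g0 c h lam1 lam2 lam : ℝ} (hg0 : 0 ≤ g0)
    (hchi1 : chi g0 c h lam1 = 0) (hchi2 : chi g0 c h lam2 = 0) (hlam : lam ∈ Ioo lam1 lam2) :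
    chi g0 c h lam < 0 := by
  have hlt : lam1 < lam2 := hlam.1.trans hlam.2
  have hsq : StrictConvexOn ℝ univ fun x : ℝ => x ^ 2 := even_two.strictConvexOn_pow two_ne_zero
  have hlin : ConvexOn ℝ univ fun x : ℝ => -c * x - 1 :=
    ((LinearMap.mulLeft ℝ (-c)).convexOn convex_univ).sub (concaveOn_const 1 convex_univ)
  have hexp : ConvexOn ℝ univ fun x : ℝ => g0 * Real.exp (-(c * h) * x) :=
    (convexOn_exp.comp_linearMap (LinearMap.mulLeft ℝ (-(c * h)))).smul hg0
  have hconv : StrictConvexOn ℝ univ (chi g0 c h) := by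
    have := (hsq.add_convexOn hlin).add_convexOn hexp
    have e : chi g0 c h = ((fun x : ℝ => x ^ 2) + fun x => -c * x - 1)
        + fun x => g0 * Real.exp (-(c * h) * x) := by
      funext x
      simp only [chi, Pi.add_apply]
      ring_nf
    rwa [e]
  have := hconv.lt_on_openSegment (mem_univ lam1) (mem_univ lam2) hlt.ne
    (by rwa [openSegment_eq_Ioo hlt])
  rwa [hchi1, hchi2, max_self] at this

theorem exists_decay_rate {g0 c h lam : ℝ} (hneg : chi g0 c h lam < 0) :
    ∃ γ > (0 : ℝ),
      g0 * Real.exp (-((lam * c - γ) * h)) ≤ (lam * c - γ) - lam ^ 2 + 1 := by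
  have hc : Continuous fun γ : ℝ =>
      g0 * Real.exp (-((lam * c - γ) * h)) - ((lam * c - γ) - lam ^ 2 + 1) := by fun_prop
  have h0 : g0 * Real.exp (-((lam * c - 0) * h)) - ((lam * c - 0) - lam ^ 2 + 1) < 0 := by
    unfold chi at hneg
    rw [sub_zero]
    linarith
  have hev := (hc.tendsto 0).eventually (gt_mem_nhds h0)
  obtain ⟨γ, hγ, hpos⟩ := ((hev.filter_mono nhdsWithin_le_nhds).and
    (self_mem_nhdsWithin : Ioi (0 : ℝ) ∈ nhdsWithin 0 (Ioi 0))).exists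
  exact ⟨γ, hpos, by linarith⟩

/-- The Lipschitz bound on `[0, ∞)` extends to the whole line when `L_g = g'(0)`. -/
theorem HypH.lipschitz_global {g : ℝ → ℝ} {kap del0 Lg : ℝ} (hH : HypH g kap del0 Lg)
    (hLg : Lg = deriv g 0) (u v : ℝ) : |g u - g v| ≤ Lg * |u - v| := by
  have hpos : 0 ≤ Lg := by linarith [hH.deriv0_gt]
  have hext : ∀ x ≤ 0, g x = Lg * x := fun x hx => hLg ▸ hH.ext_linear x hx
  have hmixed : ∀ a b : ℝ, a ≤ 0 → 0 ≤ b → |g a - g b| ≤ Lg * |a - b| := by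
    intro a b ha hb
    have h0 : g 0 = 0 := by simpa using hext 0 le_rfl
    have h1 := hH.lipschitz 0 b le_rfl hb
    rw [h0, zero_sub, zero_sub, abs_neg, abs_neg, abs_of_nonneg hb] at h1
    have h2 := abs_le.1 h1
    have h3 : Lg * a ≤ 0 := mul_nonpos_of_nonneg_of_nonpos hpos ha
    rw [abs_sub_comm a b, abs_of_nonneg (by linarith : 0 ≤ b - a), hext a ha, abs_le]
    constructor <;> nlinarith
  rcases le_total u 0 with hu | hu <;> rcases le_total v 0 with hv | hv
  · rw [hext u hu, hext v hv, ← mul_sub, abs_mul, abs_of_nonneg hpos]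
  · exact hmixed u v hu hv
  · rw [abs_sub_comm, abs_sub_comm u v]
    exact hmixed v u hv hu
  · exact hH.lipschitz u v hu hv

/-- **Theorem 3A (exponential convergence to semi-wavefronts, possibly non-monotone `g`).**
Under (UM), `c > c_#`, `λ ∈ (λ₁(c),λ₂(c))`, and a finite `|·|_λ` initial perturbation,
the solution converges to the semi-wavefront exponentially in the `e^{λ(x+ct)}`-weighted
uniform norm. -/
theorem semi_wavefront_exponential_convergence
    (g : ℝ → ℝ) (kap del0 Lg h c : ℝ)
    -- (UM): (H), L_g = g'(0), g bounded
    (hH : HypH g kap del0 Lg) (hLg : Lg = deriv g 0)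
    (hbdd : ∃ M : ℝ, ∀ x : ℝ, 0 ≤ x → g x ≤ M)
    (hh : 0 < h) (hc : 0 < c)
    (w0 : ℝ → ℝ → ℝ) (hIC1 : IC1 h w0)
    -- c > c_# : χ₀(·;c) has two distinct positive real zeros λ₁ < λ₂
    (lam1 lam2 : ℝ) (hlam1_pos : 0 < lam1) (hlam_lt : lam1 < lam2)
    (hchi1 : chi (deriv g 0) c h lam1 = 0) (hchi2 : chi (deriv g 0) c h lam2 = 0)
    (lam : ℝ) (hlam : lam ∈ Set.Ioo lam1 lam2)
    (φ : ℝ → ℝ) (hφ : IsSemiWavefront g h c φ)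
    -- sup_{s∈[−h,0]} |φ(·+cs) − w₀(s,·)|_λ < ∞
    (hpert : ∃ M : ℝ, ∀ s ∈ Set.Icc (-h) 0, ∀ x : ℝ,
        |φ (x + c * s) - w0 s x| ≤ M * eta lam x)
    -- u : a classical solution of (*) with initial datum w₀
    (u : ℝ → ℝ → ℝ) (hu : SolvesStar g h u)
    (hinit : ∀ s ∈ Set.Icc (-h) 0, ∀ x : ℝ, u s x = w0 s x) :
    ∃ C > (0:ℝ), ∃ γ > (0:ℝ), ∀ t ≥ (0:ℝ), ∀ x : ℝ,
      |u t x - φ (x + c * t)| ≤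
        C * Real.exp (-(γ * t)) * Real.exp (lam * (x + c * t)) := by
  have hLpos : 0 ≤ Lg := by linarith [hH.deriv0_gt]
  have hlam_pos : 0 < lam := hlam1_pos.trans hlam.1
  obtain ⟨γ, hγ, hrate⟩ := exists_decay_rate
    (chi_neg_of_mem_Ioo (by linarith) hchi1 hchi2 hlam)
  rw [← hLg] at hrate
  obtain ⟨M, hM⟩ := hpert
  obtain ⟨hφpos, ⟨B, hB⟩, hφsmooth, hφeq, -, -⟩ := hφ
  obtain ⟨hucont, hubdd, hueq, -, -, -⟩ := hu
  have hφ1 : ∀ z, HasDerivAt φ (deriv φ z) z := fun z =>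
    (hφsmooth.differentiable two_ne_zero z).hasDerivAt
  have hφ2 : ∀ z, HasDerivAt (deriv φ) (deriv (deriv φ) z) z := fun z =>
    (((contDiff_succ_iff_deriv (n := 1)).1 hφsmooth).2.2.differentiable one_ne_zero z).hasDerivAt
  set K := (|M| + 1) * Real.exp (lam * c * h) with hKdef
  have hK : 0 < K := by positivity
  refine ⟨K, hK, γ, hγ, fun t ht x => ?_⟩
  have key := abs_le_exp_of_delayed_inequality (L := Lg) (h := h) (K := K) (a := lam * c - γ)
    (lam := lam) (D := fun t x => u t x - φ (x + c * t))
    (dt := fun t x => deriv (fun τ => u τ x) t - deriv φ (x + c * t) * c)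
    (dx := fun t x => deriv (fun y => u t y) x - deriv φ (x + c * t))
    (dxx := fun t x => deriv (deriv (fun y => u t y)) x - deriv (deriv φ) (x + c * t))
    hLpos hh hK.le hrate ?_ ?_ ?_ ?_ ?_ ?_ ?_ ht x
  · rw [mul_assoc, ← Real.exp_add]
    convert key using 3
    ring
  · refine hucont.sub (Continuous.continuousOn ?_)
    have := hφsmooth.continuous
    fun_prop
  · intro T
    obtain ⟨N, hN⟩ := hubdd T
    refine ⟨N + B, fun s hs y => (abs_sub _ _).trans (add_le_add (hN s hs y) ?_)⟩
    rw [abs_of_pos (hφpos _)]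
    exact hB _
  · intro s hs y
    refine (hueq s hs y).1.hasDerivAt.sub ((hφ1 (y + c * s)).comp s ?_)
    simpa using ((hasDerivAt_id s).const_mul c).const_add y
  · intro s hs y
    exact (hueq s hs y).2.1.hasDerivAt.sub ((hφ1 (y + c * s)).comp_add_const y (c * s))
  · intro s hs y
    exact (hueq s hs y).2.2.1.hasDerivAt.sub ((hφ2 (y + c * s)).comp_add_const y (c * s))
  · intro s hs y
    have h1 := (hueq s hs y).2.2.2
    have h2 := hφeq (y + c * s)
    have e : y + c * s - c * h = y + c * (s - h) := by ring
    rw [e] at h2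
    have h3 := hH.lipschitz_global hLg (u (s - h) y) (φ (y + c * (s - h)))
    convert h3 using 2
    linarith
  · intro s hs y
    rw [hinit s hs y, abs_sub_comm]
    refine (hM s hs y).trans ?_
    have heta : eta lam y ≤ Real.exp (lam * y) := min_le_left _ _
    have heta0 : 0 ≤ eta lam y := le_min (Real.exp_pos _).le zero_le_one
    calc M * eta lam y ≤ (|M| + 1) * Real.exp (lam * y) :=
          mul_le_mul (by linarith [le_abs_self M]) heta heta0 (by positivity)
      _ ≤ (|M| + 1) * Real.exp (lam * c * h + ((lam * c - γ) * s + lam * y)) := by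
          refine mul_le_mul_of_nonneg_left (Real.exp_le_exp.2 ?_) (by positivity)
          have h1 : 0 ≤ lam * c * (h + s) :=
            mul_nonneg (by positivity) (by linarith [hs.1])
          have h2 : 0 ≤ γ * -s := mul_nonneg hγ.le (by linarith [hs.2])
          linarith
      _ = K * Real.exp ((lam * c - γ) * s + lam * y) := by
          rw [hKdef, Real.exp_add]
          ring
end
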